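/- Let q : (-∞,0] → ℝ be continuous, let f₁, f₂ : ℝ → ℝ be smooth functions vanishing on (-∞,0], and let w₁, w₂ : {(x,s) : x ≤ 0, −x ≤ s} → ℝ be twice continuously differentiable kernels satisfying the Goursat problems: (wᵢ)_ss(x,s) − (wᵢ)_xx(x,s) + q(x) wᵢ(x,s) = 0 for 0 < −x < s (i = 1,2), together with the characteristic conditions (d/dx)[w₁(x,−x)] = −q(x)/4 and (d/dx)[w₂(x,−x)] = −q(x)/4 for x < 0. Define u(x,t) = −(1/2)f₁(t+x) − (1/2)f₂(t+x) + ∫_{−x}^t (w₁(x,s) f₁(t−s) + w₂(x,s) f₂(t−s)) ds for x < 0, t > 0. Then u_tt(x,t) − u_xx(x,t) + q(x) u(x,t) = 0 for all 0 < −x < t, and u(x,t) = 0 whenever 0 < t < −x. -/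

import Mathlib

open Set Filter Topology intervalIntegral

theorem hasDerivAt_integral_of_continuous_deriv {g g' : ℝ → ℝ → ℝ}
    (hg : Continuous (Function.uncurry g)) (hg' : Continuous (Function.uncurry g'))
    (h : ∀ x s, HasDerivAt (fun z => g z s) (g' x s) x) (a b x : ℝ) :
    HasDerivAt (fun z => ∫ s in a..b, g z s) (∫ s in a..b, g' x s) x := by
  obtain ⟨M, hM⟩ := ((isCompact_closedBall x 1).prod
    (isCompact_uIcc (a := a) (b := b))).exists_bound_of_continuousOn hg'.continuousOn
  refine (intervalIntegral.hasDerivAt_integral_of_dominated_loc_of_deriv_le (bound := fun _ => M)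
    (Metric.closedBall_mem_nhds x one_pos) ?_ ?_ ?_ ?_ ?_ ?_).2
  · exact Eventually.of_forall fun z => (hg.uncurry_left z).aestronglyMeasurable
  · exact (hg.uncurry_left x).intervalIntegrable _ _
  · exact (hg'.uncurry_left x).aestronglyMeasurable
  · exact Eventually.of_forall fun s hs z hz => hM (z, s) ⟨hz, uIoc_subset_uIcc hs⟩
  · exact continuous_const.intervalIntegrable _ _
  · exact Eventually.of_forall fun s _ z _ => h z s

/-- The **Leibniz integral rule** with both endpoints depending on the parameter. -/
theorem hasDerivAt_integral_of_continuous_deriv_of_endpoints {g g' : ℝ → ℝ → ℝ}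
    (hg : Continuous (Function.uncurry g)) (hg' : Continuous (Function.uncurry g'))
    (h : ∀ x s, HasDerivAt (fun z => g z s) (g' x s) x) {a b : ℝ → ℝ} {a' b' x : ℝ}
    (ha : HasDerivAt a a' x) (hb : HasDerivAt b b' x) :
    HasDerivAt (fun z => ∫ s in a z..b z, g z s)
      ((∫ s in a x..b x, g' x s) + g x (b x) * b' - g x (a x) * a') x := by
  have key : ∀ {c : ℝ → ℝ} {c' : ℝ}, HasDerivAt c c' x →
      HasDerivAt (fun z => ∫ s in 0..c z, g z s)
        ((∫ s in 0..c x, g' x s) + g x (c x) * c') x := by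
    intro c c' hc
    have hF := hasStrictFDerivAt_uncurry_coprod (𝕜 := ℝ) (u := (x, c x))
      (f := fun z y => ∫ s in 0..y, g z s)
      (f₁ := fun z y => ContinuousLinearMap.toSpanSingleton ℝ (∫ s in 0..y, g' z s))
      (f₂ := fun z y => ContinuousLinearMap.toSpanSingleton ℝ (g z y))
      (Eventually.of_forall fun v =>
        (hasDerivAt_integral_of_continuous_deriv hg hg' h 0 v.2 v.1).hasFDerivAt)
      (Eventually.of_forall fun v =>
        ((hg.uncurry_left v.1).integral_hasStrictDerivAt 0 v.2).hasDerivAt.hasFDerivAt)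
      ?_ ?_
    · have := hF.hasFDerivAt.comp_hasDerivAt x ((hasDerivAt_id x).prodMk hc)
      convert! this using 1
      simp [Function.HasUncurry.uncurry, mul_comm]
    · exact ((ContinuousLinearMap.toSpanSingletonCLE (𝕜 := ℝ) (E := ℝ)).continuous.comp
        (continuous_parametric_primitive_of_continuous hg')).continuousAt
    · exact ((ContinuousLinearMap.toSpanSingletonCLE (𝕜 := ℝ) (E := ℝ)).continuous.comp
        hg).continuousAt
  have hi : ∀ {k : ℝ → ℝ → ℝ}, Continuous (Function.uncurry k) → ∀ z,
      ∫ s in a z..b z, k z s = (∫ s in 0..b z, k z s) - ∫ s in 0..a z, k z s := fun hk z =>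
    (integral_interval_sub_left ((hk.uncurry_left z).intervalIntegrable _ _)
      ((hk.uncurry_left z).intervalIntegrable _ _)).symm
  rw [funext (hi hg), hi hg']
  convert! (key hb).sub (key ha) using 1
  ring

theorem deriv_eq_zero_of_forall_le_eq_zero {f : ℝ → ℝ} (hf : Differentiable ℝ f) {a : ℝ}
    (h : ∀ t ≤ a, f t = 0) : deriv f a = 0 :=
  (uniqueDiffWithinAt_Iic a).eq_deriv _ (hf a).hasDerivAt.hasDerivWithinAt
    ((hasDerivWithinAt_const a (Iic a) (0 : ℝ)).congr h (h a le_rfl))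

theorem ContDiff.exists_partial_derivs {n : WithTop ℕ∞} {w : ℝ → ℝ → ℝ}
    (hw : ContDiff ℝ (n + 1) (Function.uncurry w)) :
    ∃ wx ws : ℝ → ℝ → ℝ, ContDiff ℝ n (Function.uncurry wx) ∧
      ContDiff ℝ n (Function.uncurry ws) ∧
      (∀ x s, HasDerivAt (fun z => w z s) (wx x s) x) ∧
      (∀ x s, HasDerivAt (w x) (ws x s) s) ∧
      ∀ x, HasDerivAt (fun z => w z (-z)) (wx x (-x) - ws x (-x)) x := by
  have hd : ∀ p, HasFDerivAt (Function.uncurry w) (fderiv ℝ (Function.uncurry w) p) p :=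
    fun p => (hw.differentiable (by simp) p).hasFDerivAt
  have hc : ContDiff ℝ n (fderiv ℝ (Function.uncurry w)) := hw.fderiv_right le_rfl
  refine ⟨fun x s => fderiv ℝ (Function.uncurry w) (x, s) (1, 0),
    fun x s => fderiv ℝ (Function.uncurry w) (x, s) (0, 1),
    hc.clm_apply contDiff_const, hc.clm_apply contDiff_const, fun x s => ?_, fun x s => ?_,
    fun x => ?_⟩
  · exact (hd (x, s)).comp_hasDerivAt x ((hasDerivAt_id x).prodMk (hasDerivAt_const x s))
  · exact (hd (x, s)).comp_hasDerivAt s ((hasDerivAt_const s x).prodMk (hasDerivAt_id s))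
  · rw [← map_sub]
    convert! (hd (x, -x)).comp_hasDerivAt x ((hasDerivAt_id x).prodMk (hasDerivAt_neg x)) using 2
    simp

/-- One summand of the representation formula: its derivatives up to second order exist and it
solves the wave equation with potential `q` on `0 < -x < t`. -/
theorem exists_derivs_wave_equation_of_goursat {q f : ℝ → ℝ} (hf : ContDiff ℝ (⊤ : ℕ∞) f)
    (hf0 : ∀ t ≤ (0 : ℝ), f t = 0) {w : ℝ → ℝ → ℝ} (hw : ContDiff ℝ 2 (Function.uncurry w))
    (hgoursat : ∀ x s : ℝ, x < 0 → -x < s →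
      deriv (deriv (w x)) s - deriv (fun y => deriv (fun z => w z s) y) x + q x * w x s = 0)
    (hchar : ∀ x : ℝ, x < 0 → deriv (fun y => w y (-y)) x = -(q x) / 4)
    {v : ℝ → ℝ → ℝ}
    (hv : ∀ x t, v x t = -(1 / 2) * f (t + x) + ∫ s in (-x)..t, w x s * f (t - s)) :
    ∃ vt vtt vx vxx : ℝ → ℝ → ℝ,
      (∀ x t, HasDerivAt (v x) (vt x t) t) ∧ (∀ x t, HasDerivAt (vt x) (vtt x t) t) ∧
      (∀ x t, HasDerivAt (fun z => v z t) (vx x t) x) ∧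
      (∀ x t, HasDerivAt (fun z => vx z t) (vxx x t) x) ∧
      ∀ x t, x < 0 → -x < t → vtt x t - vxx x t + q x * v x t = 0 := by
  obtain ⟨wx, ws, hwx, hws, dwx, dws, dwd⟩ := hw.exists_partial_derivs (n := 1)
  obtain ⟨wxx, wxs, hwxx, -, dwxx, -, -⟩ := hwx.exists_partial_derivs (n := 0)
  obtain ⟨wsx, wss, -, hwss, -, dwss, -⟩ := hws.exists_partial_derivs (n := 0)
  have cw := hw.continuous
  have cwx := hwx.continuous
  have cws := hws.continuous
  have cwxx := hwxx.continuous
  have cwss := hwss.continuous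
  have hf' : ContDiff ℝ (⊤ : ℕ∞) (deriv f) := (contDiff_infty_iff_deriv.1 hf).2
  have hf'' : ContDiff ℝ (⊤ : ℕ∞) (deriv (deriv f)) := (contDiff_infty_iff_deriv.1 hf').2
  have cf := hf.continuous
  have cf' := hf'.continuous
  have cf'' := hf''.continuous
  have df : ∀ t, HasDerivAt f (deriv f t) t :=
    fun t => (hf.differentiable (by simp) t).hasDerivAt
  have df' : ∀ t, HasDerivAt (deriv f) (deriv (deriv f) t) t :=
    fun t => (hf'.differentiable (by simp) t).hasDerivAt
  have f0 : f 0 = 0 := hf0 0 le_rfl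
  have f'0 : deriv f 0 = 0 :=
    deriv_eq_zero_of_forall_le_eq_zero (hf.differentiable (by simp)) hf0
  obtain rfl : v = fun x t => -(1 / 2) * f (t + x) + ∫ s in (-x)..t, w x s * f (t - s) := by
    ext x t
    exact hv x t
  have cmul : ∀ {k : ℝ → ℝ → ℝ} {g : ℝ → ℝ}, Continuous (Function.uncurry k) → Continuous g →
      ∀ t, Continuous (Function.uncurry fun x s => k x s * g (t - s)) := fun hk hg t =>
    hk.mul (hg.comp (continuous_const.sub continuous_snd))
  have dtime : ∀ {g g' : ℝ → ℝ}, Continuous g → Continuous g' → g 0 = 0 →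
      (∀ t, HasDerivAt g (g' t) t) → ∀ x t,
      HasDerivAt (fun τ => ∫ s in (-x)..τ, w x s * g (τ - s))
        (∫ s in (-x)..t, w x s * g' (t - s)) t := by
    intro g g' hg hg' g0 dg x t
    have cwx' : ∀ {k : ℝ → ℝ}, Continuous k →
        Continuous (Function.uncurry fun τ s => w x s * k (τ - s)) := fun hk =>
      ((cw.uncurry_left x).comp continuous_snd).mul
        (hk.comp (continuous_fst.sub continuous_snd))
    convert! hasDerivAt_integral_of_continuous_deriv_of_endpoints (cwx' hg) (cwx' hg')
      (fun τ s => ((dg (τ - s)).comp_sub_const τ s).const_mul (w x s))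
      (hasDerivAt_const t (-x)) (hasDerivAt_id t) using 1
    simp [g0]
  have dspace : ∀ {k k' : ℝ → ℝ → ℝ}, Continuous (Function.uncurry k) →
      Continuous (Function.uncurry k') → (∀ x s, HasDerivAt (fun z => k z s) (k' x s) x) →
      ∀ x t, HasDerivAt (fun z => ∫ s in (-z)..t, k z s * f (t - s))
        ((∫ s in (-x)..t, k' x s * f (t - s)) + k x (-x) * f (t + x)) x := by
    intro k k' hk hk' dk x t
    convert! hasDerivAt_integral_of_continuous_deriv_of_endpoints (cmul hk cf t) (cmul hk' cf t)
      (fun z s => (dk z s).mul_const (f (t - s)))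
      (hasDerivAt_neg x) (hasDerivAt_const x t) using 1
    simp
  refine ⟨fun x t => -(1 / 2) * deriv f (t + x) + ∫ s in (-x)..t, w x s * deriv f (t - s),
    fun x t => -(1 / 2) * deriv (deriv f) (t + x)
      + ∫ s in (-x)..t, w x s * deriv (deriv f) (t - s),
    fun x t => -(1 / 2) * deriv f (t + x)
      + ((∫ s in (-x)..t, wx x s * f (t - s)) + w x (-x) * f (t + x)),
    fun x t => -(1 / 2) * deriv (deriv f) (t + x)
      + (((∫ s in (-x)..t, wxx x s * f (t - s)) + wx x (-x) * f (t + x))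
        + ((wx x (-x) - ws x (-x)) * f (t + x) + w x (-x) * deriv f (t + x))),
    fun x t => (((df (t + x)).comp_add_const t x).const_mul _).add (dtime cf cf' f0 df x t),
    fun x t => (((df' (t + x)).comp_add_const t x).const_mul _).add
      (dtime cf' cf'' f'0 df' x t),
    fun x t => (((df (t + x)).comp_const_add t x).const_mul _).add (dspace cw cwx dwx x t),
    fun x t => (((df' (t + x)).comp_const_add t x).const_mul _).add
      ((dspace cwx cwxx dwxx x t).add ((dwd x).mul ((df (t + x)).comp_const_add t x))),
    fun x t hx ht => ?_⟩
  have int : ∀ {k : ℝ → ℝ → ℝ} {g : ℝ → ℝ}, Continuous (Function.uncurry k) → Continuous g →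
      IntervalIntegrable (fun s => k x s * g (t - s)) MeasureTheory.volume (-x) t :=
    fun hk hg => ((cmul hk hg t).uncurry_left x).intervalIntegrable _ _
  have parts : ∀ {k k' : ℝ → ℝ → ℝ} {g g' : ℝ → ℝ}, Continuous (Function.uncurry k) →
      Continuous (Function.uncurry k') → Continuous g → Continuous g' →
      (∀ s, HasDerivAt (k x) (k' x s) s) → (∀ t, HasDerivAt g (g' t) t) → g 0 = 0 →
      ∫ s in (-x)..t, k x s * g' (t - s)
        = k x (-x) * g (t + x) + ∫ s in (-x)..t, k' x s * g (t - s) := by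
    intro k k' g g' hk hk' hg hg' dk dg g0
    have := integral_eq_sub_of_hasDerivAt (a := -x) (b := t)
      (fun s _ => (dk s).mul ((dg (t - s)).comp_const_sub t s))
      (((int hk' hg).sub (int hk hg')).congr fun s _ => by simp; ring)
    simp only [mul_neg, ← sub_eq_add_neg, Pi.mul_apply] at this
    rw [integral_sub (int hk' hg) (int hk hg')] at this
    simp only [sub_self, g0, sub_neg_eq_add] at this
    linarith
  have hd := (dwd x).deriv.symm.trans (hchar x hx)
  have hpde : ∫ s in (-x)..t, (wss x s * f (t - s) - wxx x s * f (t - s)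
      + q x * (w x s * f (t - s))) = 0 := by
    refine integral_zero_ae (Eventually.of_forall fun s hs => ?_)
    rw [uIoc_of_le ht.le] at hs
    have h := hgoursat x s hx hs.1
    rw [funext fun s => (dws x s).deriv, (dwss x s).deriv, funext fun y => (dwx y s).deriv,
      (dwxx x s).deriv] at h
    linear_combination f (t - s) * h
  rw [integral_add ((int cwss cf).sub (int cwxx cf)) ((int cw cf).const_mul _),
    integral_sub (int cwss cf) (int cwxx cf), integral_const_mul] at hpde
  have h1 := parts cw cws cf' cf'' (dws x) df' f'0
  have h2 := parts cws cwss cf cf' (dwss x) df f0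
  simp only
  linear_combination hpde + h1 + h2 - 2 * f (t + x) * hd

/-- Representation of the solution of the wave equation with potential `q` on the
half-line `x < 0` driven by a control at the origin: if the kernels `w₁, w₂`
solve the Goursat problems with characteristic conditions
`(d/dx)[w₁(x,−x)] = −q(x)/4`, `(d/dx)[w₂(x,−x)] = −q(x)/4`, then
`u(x,t) = −½f₁(t+x) − ½f₂(t+x) + ∫_{−x}^t (w₁(x,s)f₁(t−s) + w₂(x,s)f₂(t−s)) ds`
satisfies `u_tt − u_xx + q u = 0` for `0 < −x < t` and vanishes for `0 < t < −x`. -/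
theorem stmt5 (q : ℝ → ℝ) (hq : ContinuousOn q (Iic 0))
    (f₁ f₂ : ℝ → ℝ)
    (hf₁ : ContDiff ℝ (⊤ : ℕ∞) f₁) (hf₂ : ContDiff ℝ (⊤ : ℕ∞) f₂)
    (hf₁0 : ∀ t ≤ (0 : ℝ), f₁ t = 0) (hf₂0 : ∀ t ≤ (0 : ℝ), f₂ t = 0)
    (w₁ w₂ : ℝ → ℝ → ℝ)
    (hw₁ : ContDiff ℝ 2 (Function.uncurry w₁))
    (hw₂ : ContDiff ℝ 2 (Function.uncurry w₂))
    -- Goursat equations `(wᵢ)_ss − (wᵢ)_xx + q wᵢ = 0` for `0 < −x < s`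
    (hgoursat₁ : ∀ x s : ℝ, x < 0 → -x < s →
      deriv (deriv (w₁ x)) s - deriv (fun y => deriv (fun z => w₁ z s) y) x
        + q x * w₁ x s = 0)
    (hgoursat₂ : ∀ x s : ℝ, x < 0 → -x < s →
      deriv (deriv (w₂ x)) s - deriv (fun y => deriv (fun z => w₂ z s) y) x
        + q x * w₂ x s = 0)
    -- characteristic conditions on the anti-diagonal
    (hchar₁ : ∀ x : ℝ, x < 0 → deriv (fun y => w₁ y (-y)) x = -(q x) / 4)
    (hchar₂ : ∀ x : ℝ, x < 0 → deriv (fun y => w₂ y (-y)) x = -(q x) / 4)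
    (u : ℝ → ℝ → ℝ)
    (hu : ∀ x t : ℝ, x < 0 →
      u x t = -(1 / 2) * f₁ (t + x) - (1 / 2) * f₂ (t + x)
        + ∫ s in (-x)..t, (w₁ x s * f₁ (t - s) + w₂ x s * f₂ (t - s))) :
    (∀ x t : ℝ, 0 < -x → -x < t →
      deriv (fun τ => deriv (fun σ => u x σ) τ) t
        - deriv (fun y => deriv (fun z => u z t) y) x
        + q x * u x t = 0) ∧
    ∀ x t : ℝ, 0 < t → t < -x → u x t = 0 := by
  set v : (ℝ → ℝ) → (ℝ → ℝ → ℝ) → ℝ → ℝ → ℝ := fun f w x t =>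
    -(1 / 2) * f (t + x) + ∫ s in (-x)..t, w x s * f (t - s) with hv
  have huv : ∀ x t, x < 0 → u x t = v f₁ w₁ x t + v f₂ w₂ x t := by
    intro x t hx
    have int : ∀ {f : ℝ → ℝ} {w : ℝ → ℝ → ℝ}, ContDiff ℝ (⊤ : ℕ∞) f →
        ContDiff ℝ 2 (Function.uncurry w) →
        IntervalIntegrable (fun s => w x s * f (t - s)) MeasureTheory.volume (-x) t :=
      fun hf hw => ((hw.continuous.uncurry_left x).mul
        (hf.continuous.comp (continuous_const.sub continuous_id))).intervalIntegrable _ _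
    rw [hu x t hx, integral_add (int hf₁ hw₁) (int hf₂ hw₂)]
    simp only [hv]
    ring
  constructor
  · intro x t hx ht
    have hx : x < 0 := neg_pos.1 hx
    obtain ⟨at₁, att₁, ax₁, axx₁, dt₁, dtt₁, dx₁, dxx₁, e₁⟩ :=
      exists_derivs_wave_equation_of_goursat hf₁ hf₁0 hw₁ hgoursat₁ hchar₁
        (v := v f₁ w₁) fun _ _ => rfl
    obtain ⟨at₂, att₂, ax₂, axx₂, dt₂, dtt₂, dx₂, dxx₂, e₂⟩ :=
      exists_derivs_wave_equation_of_goursat hf₂ hf₂0 hw₂ hgoursat₂ hchar₂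
        (v := v f₂ w₂) fun _ _ => rfl
    have ht2 : deriv (fun τ => deriv (fun σ => u x σ) τ) t = att₁ x t + att₂ x t := by
      rw [funext fun σ => huv x σ hx, funext fun τ => ((dt₁ x τ).fun_add (dt₂ x τ)).deriv]
      exact ((dtt₁ x t).add (dtt₂ x t)).deriv
    have hx2 : deriv (fun y => deriv (fun z => u z t) y) x = axx₁ x t + axx₂ x t := by
      have h : (fun y => deriv (fun z => u z t) y) =ᶠ[𝓝 x] fun y => ax₁ y t + ax₂ y t := by
        filter_upwards [Iio_mem_nhds hx] with y hy
        have : (fun z => u z t) =ᶠ[𝓝 y] fun z => v f₁ w₁ z t + v f₂ w₂ z t := by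
          filter_upwards [Iio_mem_nhds hy] with z hz using huv z t hz
        rw [this.deriv_eq]
        exact ((dx₁ y t).add (dx₂ y t)).deriv
      rw [h.deriv_eq]
      exact ((dxx₁ x t).add (dxx₂ x t)).deriv
    rw [ht2, hx2, huv x t hx]
    linear_combination e₁ x t hx ht + e₂ x t hx ht
  · intro x t ht hx
    rw [hu x t (by linarith), hf₁0 _ (by linarith), hf₂0 _ (by linarith),
      integral_zero_ae (Eventually.of_forall fun s hs => ?_)]
    · simp
    · rw [uIoc_of_ge hx.le] at hs
      rw [hf₁0 _ (by linarith [hs.1]), hf₂0 _ (by linarith [hs.1])]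
      simp
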